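/- (AE Theorem) Let F ⊆ U × ℝ × ℝⁿ × Sym²(ℝⁿ) be a closed set satisfying positivity: (x,r,p,A) ∈ F and P positive semidefinite imply (x,r,p,A+P) ∈ F. Let u : U → ℝ be λ-quasi-convex on the open set U ⊆ ℝⁿ. If for almost every x ∈ U the function u is twice differentiable at x and (x, u(x), Du(x), D²u(x)) ∈ F, then u is F-subharmonic on U: for every x ∈ U and every upper contact jet (p,A) of u at x, one has (x, u(x), p, A) ∈ F. -/

import Mathlib

open scoped RealInnerProductSpace Topology
open Filter MeasureTheory

/-- The quadratic form `⟨A v, v⟩` associated to a matrix `A`. -/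
noncomputable def quad {n : ℕ} (A : Matrix (Fin n) (Fin n) ℝ)
    (v : EuclideanSpace ℝ (Fin n)) : ℝ :=
  ∑ i, ∑ j, A i j * v i * v j

/-- `(p, A)` is an upper contact jet for `w` at `x₀`. -/
def UpperContactJet {n : ℕ} (w : EuclideanSpace ℝ (Fin n) → ℝ)
    (x₀ p : EuclideanSpace ℝ (Fin n)) (A : Matrix (Fin n) (Fin n) ℝ) : Prop :=
  ∀ᶠ y in 𝓝 x₀, w y ≤ w x₀ + ⟪p, y - x₀⟫ + (1 / 2) * quad A (y - x₀)

/-- `w` is twice differentiable at `x` with gradient `g` and Hessian `H`, in the sense of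
a second-order Taylor expansion. -/
def TwiceDiffAt {n : ℕ} (w : EuclideanSpace ℝ (Fin n) → ℝ)
    (x g : EuclideanSpace ℝ (Fin n)) (H : Matrix (Fin n) (Fin n) ℝ) : Prop :=
  HasGradientAt w g x ∧
    (fun y => w y - w x - ⟪g, y - x⟫ - (1 / 2) * quad H (y - x)) =o[𝓝 x]
      fun y => ‖y - x‖ ^ 2

/-- `w` is `lam`-quasi-convex on `U`: `w + (lam/2)|·|²` is convex on `U`. -/
def QCOn {n : ℕ} (lam : ℝ) (U : Set (EuclideanSpace ℝ (Fin n)))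
    (w : EuclideanSpace ℝ (Fin n) → ℝ) : Prop :=
  ConvexOn ℝ U (fun x => w x + (lam / 2) * ‖x‖ ^ 2)

/-- The 2-jet space `ℝⁿ × ℝ × ℝⁿ × Sym²(ℝⁿ)` (symmetry imposed separately). -/
abbrev Jet (n : ℕ) :=
  EuclideanSpace ℝ (Fin n) × ℝ × EuclideanSpace ℝ (Fin n) × Matrix (Fin n) (Fin n) ℝ

/-- Positivity condition (P) for a set of 2-jets. -/
def Positivity {n : ℕ} (F : Set (Jet n)) : Prop :=
  ∀ x : EuclideanSpace ℝ (Fin n), ∀ r : ℝ, ∀ p : EuclideanSpace ℝ (Fin n),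
    ∀ A P : Matrix (Fin n) (Fin n) ℝ,
      (x, r, p, A) ∈ F → P.PosSemidef → (x, r, p, A + P) ∈ F

/-- `u` is `F`-subharmonic on `U`: every upper contact jet of `u` at a point of `U`
belongs to `F`. -/
def Subharm {n : ℕ} (F : Set (Jet n)) (U : Set (EuclideanSpace ℝ (Fin n)))
    (u : EuclideanSpace ℝ (Fin n) → ℝ) : Prop :=
  ∀ x ∈ U, ∀ (p : EuclideanSpace ℝ (Fin n)) (A : Matrix (Fin n) (Fin n) ℝ),
    A.IsSymm → UpperContactJet u x p A → (x, u x, p, A) ∈ F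

open scoped MeasureTheory

section Jensen

variable {E : Type*} [NormedAddCommGroup E] [InnerProductSpace ℝ E]

/-- If `w` lies below its value plus a linear function on a ball, and is midpoint semiconvex,
then it also lies above that linear function up to a quadratic error. -/
theorem lower_bound_of_contact {w : E → ℝ} {x₀ x q h : E} {r Λ ρ : ℝ} (hr : 4 * ρ ≤ r)
    (hsc : ∀ x h, x ∈ Metric.closedBall x₀ r → x + h ∈ Metric.closedBall x₀ r →
      x - h ∈ Metric.closedBall x₀ r → 2 * w x ≤ w (x + h) + w (x - h) + Λ * ‖h‖ ^ 2)
    (hx : ‖x - x₀‖ ≤ ρ) (hh : ‖h‖ ≤ 3 * ρ)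
    (hq : ∀ y ∈ Metric.closedBall x₀ r, w y ≤ w x + ⟪q, y - x⟫) :
    w x + ⟪q, h⟫ - Λ * ‖h‖ ^ 2 ≤ w (x + h) := by
  have hmem : ∀ k : E, ‖k‖ ≤ 3 * ρ → x + k ∈ Metric.closedBall x₀ r := by
    intro k hk
    rw [mem_closedBall_iff_norm, add_sub_right_comm]
    linarith [norm_add_le (x - x₀) k]
  have h₁ := hmem h hh
  have h₂ := hmem (-h) (by rwa [norm_neg])
  have h₀ := hmem 0 (by rw [norm_zero]; exact (norm_nonneg h).trans hh)
  rw [← sub_eq_add_neg] at h₂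
  rw [add_zero] at h₀
  have h₃ := hq _ h₂
  have h₄ := hsc x h h₀ h₁ h₂
  rw [sub_sub_cancel_left, inner_neg_right] at h₃
  linarith

/-- Slopes at contact points depend on the contact point in a Lipschitz way. -/
theorem norm_sub_le_of_contact {w : E → ℝ} {x₀ x₁ x₂ q₁ q₂ : E} {r Λ ρ : ℝ} (hr : 4 * ρ ≤ r)
    (hΛ : 0 ≤ Λ)
    (hsc : ∀ x h, x ∈ Metric.closedBall x₀ r → x + h ∈ Metric.closedBall x₀ r →
      x - h ∈ Metric.closedBall x₀ r → 2 * w x ≤ w (x + h) + w (x - h) + Λ * ‖h‖ ^ 2)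
    (hx₁ : ‖x₁ - x₀‖ < ρ) (hx₂ : ‖x₂ - x₀‖ < ρ)
    (hq₁ : ∀ y ∈ Metric.closedBall x₀ r, w y ≤ w x₁ + ⟪q₁, y - x₁⟫)
    (hq₂ : ∀ y ∈ Metric.closedBall x₀ r, w y ≤ w x₂ + ⟪q₂, y - x₂⟫) :
    ‖q₁ - q₂‖ ≤ 2 * Λ * ‖x₁ - x₂‖ := by
  have hd : ‖x₁ - x₂‖ < 2 * ρ := by
    calc ‖x₁ - x₂‖ = ‖(x₁ - x₀) - (x₂ - x₀)‖ := by rw [sub_sub_sub_cancel_right]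
      _ ≤ ‖x₁ - x₀‖ + ‖x₂ - x₀‖ := norm_sub_le _ _
      _ < 2 * ρ := by linarith
  have key : ∀ s, ‖x₁ - x₂‖ < s → s < 2 * ρ → ‖q₁ - q₂‖ ≤ 2 * Λ * s := by
    intro s hs hs'
    have hs0 : 0 < s := (norm_nonneg _).trans_lt hs
    rcases eq_or_ne q₁ q₂ with rfl | hne
    · rw [sub_self, norm_zero]; positivity
    have ha : 0 < ‖q₂ - q₁‖ := norm_pos_iff.2 (sub_ne_zero.2 hne.symm)
    set h : E := (s / ‖q₂ - q₁‖) • (q₂ - q₁) with hh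
    have hnorm : ‖h‖ = s := by
      rw [hh, norm_smul, Real.norm_of_nonneg (by positivity), div_mul_cancel₀ _ ha.ne']
    have hinner : ⟪q₂ - q₁, h⟫ = s * ‖q₂ - q₁‖ := by
      rw [hh, inner_smul_right, real_inner_self_eq_norm_sq]
      field_simp
    have h₂ := lower_bound_of_contact hr hsc hx₂.le (h := h) (by linarith) hq₂
    have h₁ := lower_bound_of_contact hr hsc hx₁.le (h := x₂ - x₁)
      (by rw [norm_sub_rev]; linarith) hq₁
    have h₃ := hq₁ (x₂ + h) (by
      rw [mem_closedBall_iff_norm, add_sub_right_comm]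
      linarith [norm_add_le (x₂ - x₀) h])
    rw [add_sub_cancel, norm_sub_rev] at h₁
    rw [add_sub_right_comm, inner_add_right] at h₃
    rw [inner_sub_left] at hinner
    rw [hnorm] at h₂
    have h₄ : s * ‖q₂ - q₁‖ ≤ s * (2 * Λ * s) := by
      have : Λ * ‖x₁ - x₂‖ ^ 2 ≤ Λ * s ^ 2 := by gcongr
      linarith
    rw [norm_sub_rev]
    exact le_of_mul_le_mul_left h₄ hs0
  have hlim : Tendsto (fun s : ℝ => 2 * Λ * s) (𝓝[>] ‖x₁ - x₂‖) (𝓝 (2 * Λ * ‖x₁ - x₂‖)) :=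
    ((continuous_const.mul continuous_id).tendsto _).mono_left nhdsWithin_le_nhds
  refine ge_of_tendsto hlim ?_
  filter_upwards [Ioo_mem_nhdsGT hd] with s hs using key s hs.1 hs.2

/-- Every small slope is attained at a contact point near a strict maximum. -/
theorem exists_contact [FiniteDimensional ℝ E] {w : E → ℝ} {x₀ q : E} {r ε ρ : ℝ}
    (hρ : 0 < ρ) (hr : ρ ≤ r) (hε : 0 < ε) (hq : ‖q‖ < ε * ρ)
    (hw : ContinuousOn w (Metric.closedBall x₀ r)) (hw₀ : w x₀ = 0)
    (hmax : ∀ y ∈ Metric.closedBall x₀ r, w y ≤ -(ε * ‖y - x₀‖ ^ 2)) :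
    ∃ x, ‖x - x₀‖ < ρ ∧ ∀ y ∈ Metric.closedBall x₀ r, w y ≤ w x + ⟪q, y - x⟫ := by
  have hx₀ : x₀ ∈ Metric.closedBall x₀ r := Metric.mem_closedBall_self (hρ.le.trans hr)
  obtain ⟨x, hx, hxmax⟩ := (isCompact_closedBall x₀ r).exists_isMaxOn ⟨x₀, hx₀⟩
    (f := fun y => w y - ⟪q, y - x₀⟫) (by fun_prop)
  rw [isMaxOn_iff] at hxmax
  refine ⟨x, ?_, fun y hy => ?_⟩
  · by_contra! hle
    have h₁ := hxmax x₀ hx₀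
    have h₂ := hmax x hx
    have h₃ := real_inner_le_norm (-q) (x - x₀)
    rw [inner_neg_left, norm_neg] at h₃
    rw [sub_self, inner_zero_right, hw₀] at h₁
    have h₄ : ‖q‖ * ‖x - x₀‖ < ε * ‖x - x₀‖ ^ 2 := by
      have : 0 < ‖x - x₀‖ := hρ.trans_le hle
      calc ‖q‖ * ‖x - x₀‖ < ε * ρ * ‖x - x₀‖ := by gcongr
        _ ≤ ε * ‖x - x₀‖ * ‖x - x₀‖ := by gcongr
        _ = _ := by ring
    linarith
  · have h₁ := hxmax y hy
    have h₂ : ⟪q, y - x⟫ = ⟪q, y - x₀⟫ - ⟪q, x - x₀⟫ := by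
      rw [← inner_sub_right, sub_sub_sub_cancel_right]
    linarith

/-- **Jensen's lemma**: near a strict maximum of a semiconvex function, the set of points of
contact with affine functions of small slope is not negligible. -/
theorem measure_contact_ne_zero [FiniteDimensional ℝ E] [MeasurableSpace E] [BorelSpace E]
    (μ : Measure E) [μ.IsAddHaarMeasure] {w : E → ℝ} {x₀ : E} {r ε ρ Λ : ℝ} (hΛ : 0 ≤ Λ)
    (hρ : 0 < ρ) (hr : 4 * ρ ≤ r) (hε : 0 < ε)
    (hw : ContinuousOn w (Metric.closedBall x₀ r)) (hw₀ : w x₀ = 0)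
    (hmax : ∀ y ∈ Metric.closedBall x₀ r, w y ≤ -(ε * ‖y - x₀‖ ^ 2))
    (hsc : ∀ x h, x ∈ Metric.closedBall x₀ r → x + h ∈ Metric.closedBall x₀ r →
      x - h ∈ Metric.closedBall x₀ r → 2 * w x ≤ w (x + h) + w (x - h) + Λ * ‖h‖ ^ 2) :
    μ {x | ‖x - x₀‖ < ρ ∧ ∃ q : E, ‖q‖ < ρ ∧
      ∀ y ∈ Metric.closedBall x₀ r, w y ≤ w x + ⟪q, y - x⟫} ≠ 0 := by
  set K := {x | ‖x - x₀‖ < ρ ∧ ∃ q : E, ‖q‖ < ρ ∧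
      ∀ y ∈ Metric.closedBall x₀ r, w y ≤ w x + ⟪q, y - x⟫} with hK
  intro hnull
  set η := min ρ (ε * ρ) with hη
  have hη0 : 0 < η := lt_min hρ (mul_pos hε hρ)
  have hex : ∀ q : Metric.ball (0 : E) η, ∃ x, ‖x - x₀‖ < ρ ∧
      ∀ y ∈ Metric.closedBall x₀ r, w y ≤ w x + ⟪(q : E), y - x⟫ := fun q =>
    exists_contact hρ (by linarith) hε
      ((mem_ball_zero_iff.1 q.2).trans_le (min_le_right _ _)) hw hw₀ hmax
  choose f hf hfc using hex
  have hanti : AntilipschitzWith (2 * Λ).toNNReal f := by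
    refine AntilipschitzWith.of_le_mul_dist fun a b => ?_
    rw [Subtype.dist_eq, dist_eq_norm, dist_eq_norm, Real.coe_toNNReal _ (by positivity)]
    exact norm_sub_le_of_contact hr hΛ hsc (hf a) (hf b) (hfc a) (hfc b)
  have hKH : μH[Module.finrank ℝ E] K = 0 :=
    Measure.absolutelyContinuous_isAddHaarMeasure _ μ hnull
  have hpre : f ⁻¹' K = Set.univ := Set.eq_univ_of_forall fun q =>
    ⟨hf q, q, (mem_ball_zero_iff.1 q.2).trans_le (min_le_left _ _), hfc q⟩
  have h₁ := hanti.hausdorffMeasure_preimage_le (d := Module.finrank ℝ E) (by positivity) K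
  rw [hpre, hKH, mul_zero, ← isometry_subtype_coe.hausdorffMeasure_image
    (Or.inl (by positivity)), Set.image_univ, Subtype.range_coe] at h₁
  exact (Metric.measure_ball_pos (μH[Module.finrank ℝ E]) (0 : E) hη0).not_ge h₁

end Jensen

section Quad

variable {n : ℕ}

theorem quad_eq_inner (A : Matrix (Fin n) (Fin n) ℝ) (v : EuclideanSpace ℝ (Fin n)) :
    quad A v = ⟪v, Matrix.toEuclideanCLM (𝕜 := ℝ) A v⟫ := by
  rw [Matrix.inner_toEuclideanCLM]
  simp only [quad, dotProduct, Matrix.mulVec, Finset.mul_sum]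
  exact Finset.sum_congr rfl fun i _ => Finset.sum_congr rfl fun j _ => by ring

theorem quad_add_smul_one (A : Matrix (Fin n) (Fin n) ℝ) (c : ℝ)
    (v : EuclideanSpace ℝ (Fin n)) : quad (A + c • 1) v = quad A v + c * ‖v‖ ^ 2 := by
  simp [quad_eq_inner, inner_add_right, inner_smul_right]

theorem quad_sub (A B : Matrix (Fin n) (Fin n) ℝ) (v : EuclideanSpace ℝ (Fin n)) :
    quad (A - B) v = quad A v - quad B v := by
  simp [quad_eq_inner, inner_sub_right]

theorem quad_smul (A : Matrix (Fin n) (Fin n) ℝ) (t : ℝ) (v : EuclideanSpace ℝ (Fin n)) :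
    quad A (t • v) = t ^ 2 * quad A v := by
  simp only [quad_eq_inner, map_smul, inner_smul_left, inner_smul_right, conj_trivial]
  ring

theorem quad_parallelogram (A : Matrix (Fin n) (Fin n) ℝ) (v h : EuclideanSpace ℝ (Fin n)) :
    quad A (v + h) + quad A (v - h) = 2 * quad A v + 2 * quad A h := by
  simp only [quad_eq_inner, map_add, map_sub, inner_add_left, inner_add_right, inner_sub_left,
    inner_sub_right]
  ring

theorem quad_add_of_isSymm {A : Matrix (Fin n) (Fin n) ℝ} (hA : A.IsSymm)
    (v h : EuclideanSpace ℝ (Fin n)) :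
    quad A (v + h) = quad A v + 2 * ⟪Matrix.toEuclideanCLM (𝕜 := ℝ) A v, h⟫ + quad A h := by
  have : ⟪v, Matrix.toEuclideanCLM (𝕜 := ℝ) A h⟫ = ⟪Matrix.toEuclideanCLM (𝕜 := ℝ) A v, h⟫ := by
    rw [real_inner_comm h, Matrix.inner_toEuclideanCLM, Matrix.inner_toEuclideanCLM,
      Matrix.dotProduct_mulVec, ← Matrix.mulVec_transpose, hA.eq, dotProduct_comm]
  simp only [quad_eq_inner, map_add, inner_add_left, inner_add_right, this]
  rw [real_inner_comm _ h]
  ring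

theorem quad_le_norm (A : Matrix (Fin n) (Fin n) ℝ) (v : EuclideanSpace ℝ (Fin n)) :
    quad A v ≤ ‖Matrix.toEuclideanCLM (𝕜 := ℝ) A‖ * ‖v‖ ^ 2 := by
  rw [quad_eq_inner]
  calc _ ≤ ‖v‖ * ‖Matrix.toEuclideanCLM (𝕜 := ℝ) A v‖ := real_inner_le_norm _ _
    _ ≤ ‖v‖ * (‖Matrix.toEuclideanCLM (𝕜 := ℝ) A‖ * ‖v‖) := by
      gcongr; exact ContinuousLinearMap.le_opNorm _ _
    _ = _ := by ring

theorem continuous_quad (A : Matrix (Fin n) (Fin n) ℝ) : Continuous (quad A) := by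
  unfold quad
  fun_prop

theorem posSemidef_of_quad_nonneg {P : Matrix (Fin n) (Fin n) ℝ} (hP : P.IsSymm)
    (h : ∀ v, 0 ≤ quad P v) : P.PosSemidef := by
  refine Matrix.PosSemidef.of_dotProduct_mulVec_nonneg ?_ fun v => ?_
  · rw [Matrix.IsHermitian, Matrix.conjTranspose_eq_transpose_of_trivial, hP.eq]
  · have := h (WithLp.toLp 2 v)
    rwa [quad_eq_inner, Matrix.inner_toEuclideanCLM] at this

/-- If the second-order polynomial `⟨a, h⟩ + ½⟨B h, h⟩` is at most `o(‖h‖²)`, then `a = 0`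
and `B ≤ 0`. -/
theorem eq_zero_and_quad_nonpos {a : EuclideanSpace ℝ (Fin n)} {B : Matrix (Fin n) (Fin n) ℝ}
    (h : ∀ η > 0, ∀ᶠ z in 𝓝 (0 : EuclideanSpace ℝ (Fin n)),
      ⟪a, z⟫ + (1 / 2) * quad B z ≤ η * ‖z‖ ^ 2) :
    a = 0 ∧ ∀ v, quad B v ≤ 0 := by
  have hray : ∀ η > 0, ∀ v : EuclideanSpace ℝ (Fin n), ∀ᶠ t in 𝓝[>] (0 : ℝ),
      ⟪a, v⟫ + t * ((1 / 2) * quad B v) ≤ t * (η * ‖v‖ ^ 2) := by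
    intro η hη v
    have hc : Tendsto (fun t : ℝ => t • v) (𝓝[>] 0) (𝓝 0) := by
      have : Continuous fun t : ℝ => t • v := by fun_prop
      simpa using (this.tendsto 0).mono_left nhdsWithin_le_nhds
    filter_upwards [hc.eventually (h η hη), self_mem_nhdsWithin] with t ht ht0
    rw [Set.mem_Ioi] at ht0
    rw [inner_smul_right, quad_smul, norm_smul, mul_pow, Real.norm_eq_abs, sq_abs] at ht
    refine le_of_mul_le_mul_left ?_ ht0
    linarith
  have hle : ∀ v, ⟪a, v⟫ ≤ 0 := by
    intro v
    have hc : Tendsto (fun t : ℝ => t * (1 * ‖v‖ ^ 2) - t * ((1 / 2) * quad B v))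
        (𝓝[>] 0) (𝓝 0) := by
      have : Continuous fun t : ℝ => t * (1 * ‖v‖ ^ 2) - t * ((1 / 2) * quad B v) := by fun_prop
      simpa using (this.tendsto 0).mono_left nhdsWithin_le_nhds
    refine ge_of_tendsto hc ?_
    filter_upwards [hray 1 one_pos v] with t ht
    linarith
  have ha : a = 0 := by
    have := hle a
    rw [real_inner_self_eq_norm_sq] at this
    simpa using le_antisymm this (sq_nonneg _)
  refine ⟨ha, fun v => ?_⟩
  have hη : ∀ η > 0, (1 / 2) * quad B v ≤ η * ‖v‖ ^ 2 := by
    intro η hη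
    obtain ⟨t, ht, ht0⟩ := ((hray η hη v).and self_mem_nhdsWithin).exists
    rw [ha, inner_zero_left, zero_add] at ht
    exact le_of_mul_le_mul_left ht ht0
  have hc : Tendsto (fun η : ℝ => η * ‖v‖ ^ 2) (𝓝[>] 0) (𝓝 0) := by
    have : Continuous fun η : ℝ => η * ‖v‖ ^ 2 := by fun_prop
    simpa using (this.tendsto 0).mono_left nhdsWithin_le_nhds
  have := ge_of_tendsto hc (by filter_upwards [self_mem_nhdsWithin] with η h using hη η h)
  linarith

/-- At a point of twice differentiability, an upper contact jet has the same gradient and a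
larger Hessian. -/
theorem TwiceDiffAt.eq_and_posSemidef {u : EuclideanSpace ℝ (Fin n) → ℝ}
    {x g p : EuclideanSpace ℝ (Fin n)} {H A : Matrix (Fin n) (Fin n) ℝ}
    (hu : TwiceDiffAt u x g H) (hH : H.IsSymm) (hA : A.IsSymm) (hc : UpperContactJet u x p A) :
    g = p ∧ (A - H).PosSemidef := by
  have hz : Tendsto (fun z : EuclideanSpace ℝ (Fin n) => x + z) (𝓝 0) (𝓝 x) := by
    have : Continuous fun z : EuclideanSpace ℝ (Fin n) => x + z := by fun_prop
    simpa using this.tendsto 0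
  obtain ⟨h₁, h₂⟩ := eq_zero_and_quad_nonpos (a := g - p) (B := H - A) (by
    intro η hη
    filter_upwards [hz.eventually (hu.2.bound hη), hz.eventually hc] with z h₁ h₂
    rw [add_sub_cancel_left, Real.norm_of_nonneg (sq_nonneg _)] at h₁
    rw [add_sub_cancel_left] at h₂
    rw [inner_sub_left, quad_sub]
    linarith [(abs_le.1 h₁).1])
  refine ⟨sub_eq_zero.1 h₁, posSemidef_of_quad_nonneg (hA.sub hH) fun v => ?_⟩
  have := h₂ v
  rw [quad_sub] at this ⊢
  linarith

theorem QCOn.midpoint {lam : ℝ} {U : Set (EuclideanSpace ℝ (Fin n))}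
    {u : EuclideanSpace ℝ (Fin n) → ℝ} (hu : QCOn lam U u) {x h : EuclideanSpace ℝ (Fin n)}
    (h₁ : x + h ∈ U) (h₂ : x - h ∈ U) :
    2 * u x ≤ u (x + h) + u (x - h) + lam * ‖h‖ ^ 2 := by
  have hconv : ConvexOn ℝ U (fun x => u x + (lam / 2) * ‖x‖ ^ 2) := hu
  have key := hconv.2 h₁ h₂ (show (0 : ℝ) ≤ 1 / 2 by norm_num)
    (show (0 : ℝ) ≤ 1 / 2 by norm_num) (by norm_num)
  have hx : (1 / 2 : ℝ) • (x + h) + (1 / 2 : ℝ) • (x - h) = x := by module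
  simp only [hx, smul_eq_mul] at key
  have hpar := parallelogram_law_with_norm ℝ x h
  have : lam * (‖x + h‖ ^ 2 + ‖x - h‖ ^ 2) =
    lam * (2 * (‖x‖ ^ 2 + ‖h‖ ^ 2)) := by rw [hpar]
  linarith

theorem QCOn.continuousOn {lam : ℝ} {U : Set (EuclideanSpace ℝ (Fin n))}
    {u : EuclideanSpace ℝ (Fin n) → ℝ} (hu : QCOn lam U u) (hU : IsOpen U) :
    ContinuousOn u U := by
  have h₁ := ConvexOn.continuousOn hU hu
  have h₂ : ContinuousOn (fun x : EuclideanSpace ℝ (Fin n) => (lam / 2) * ‖x‖ ^ 2) U := by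
    fun_prop
  exact (h₁.sub h₂).congr fun x _ => by simp

/-- If `(p, A)` is an upper contact jet at `x₀` of a quasi-convex function, then for
every `ε > 0` there are points arbitrarily close to `x₀`, avoiding a given null set, that admit
an upper contact jet arbitrarily close to `(p, A + ε)`. -/
theorem QCOn.exists_upperContactJet {lam : ℝ} (hlam : 0 ≤ lam)
    {U : Set (EuclideanSpace ℝ (Fin n))} (hU : IsOpen U)
    {u : EuclideanSpace ℝ (Fin n) → ℝ} (hu : QCOn lam U u)
    {x₀ p : EuclideanSpace ℝ (Fin n)} (hx₀ : x₀ ∈ U) {A : Matrix (Fin n) (Fin n) ℝ}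
    (hA : A.IsSymm) (hc : UpperContactJet u x₀ p A) {S : EuclideanSpace ℝ (Fin n) → Prop}
    (hS : ∀ᵐ x ∂(volume.restrict U), S x) {ε δ : ℝ} (hε : 0 < ε) (hδ : 0 < δ) :
    ∃ x q : EuclideanSpace ℝ (Fin n), S x ∧ ‖x - x₀‖ < δ ∧ ‖q‖ < δ ∧
      UpperContactJet u x (p + Matrix.toEuclideanCLM (𝕜 := ℝ) (A + ε • 1) (x - x₀) + q)
        (A + ε • 1) := by
  have hAε : (A + ε • 1 : Matrix (Fin n) (Fin n) ℝ).IsSymm := hA.add (by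
    rw [Matrix.IsSymm, Matrix.transpose_smul, Matrix.transpose_one])
  set B : Matrix (Fin n) (Fin n) ℝ := A + ε • 1 with hB
  obtain ⟨r, hr0, hr⟩ := Metric.nhds_basis_closedBall.eventually_iff.1
    (hc.and (hU.mem_nhds hx₀))
  set w : EuclideanSpace ℝ (Fin n) → ℝ :=
    fun y => u y - u x₀ - ⟪p, y - x₀⟫ - (1 / 2) * quad B (y - x₀) with hw
  set ρ := min δ (r / 4) with hρ
  have hρ0 : 0 < ρ := lt_min hδ (by positivity)
  have hρr : 4 * ρ ≤ r := by linarith [min_le_right δ (r / 4)]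
  set C := ‖Matrix.toEuclideanCLM (𝕜 := ℝ) B‖ with hC
  have hnull := measure_contact_ne_zero (volume : Measure (EuclideanSpace ℝ (Fin n)))
    (w := w) (x₀ := x₀) (r := r) (ε := ε / 2) (ρ := ρ) (Λ := lam + C)
    (by positivity) hρ0 hρr (by positivity)
    (by
      have h₁ : ContinuousOn u (Metric.closedBall x₀ r) :=
        (hu.continuousOn hU).mono fun y hy => (hr hy).2
      have h₂ := continuous_quad B
      fun_prop)
    (by simp [hw, quad])
    (fun y hy => by
      have := (hr hy).1
      simp only [hw, hB, quad_add_smul_one]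
      linarith)
    (fun x h _ h₁ h₂ => by
      have h₃ := hu.midpoint (hr h₁).2 (hr h₂).2
      have h₄ := quad_parallelogram B (x - x₀) h
      have h₅ := quad_le_norm B h
      simp only [hw, add_sub_right_comm x h x₀, sub_right_comm x h x₀, inner_add_right,
        inner_sub_right _ (x - x₀) h]
      linarith)
  rw [ae_restrict_iff' hU.measurableSet] at hS
  obtain ⟨x, ⟨hxρ, q, hq, hxq⟩, hSx⟩ := (frequently_ae_mem_iff.2 hnull).and_eventually hS |>.exists
  have hxr : x ∈ Metric.ball x₀ r := mem_ball_iff_norm.2 (by linarith)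
  refine ⟨x, q, hSx (hr (Metric.ball_subset_closedBall hxr)).2, hxρ.trans_le (min_le_left _ _),
    hq.trans_le (min_le_left _ _), ?_⟩
  filter_upwards [Metric.isOpen_ball.mem_nhds hxr] with y hy
  have h₁ := hxq y (Metric.ball_subset_closedBall hy)
  have h₂ := quad_add_of_isSymm hAε (x - x₀) (y - x)
  have h₃ : ⟪p, y - x₀⟫ = ⟪p, x - x₀⟫ + ⟪p, y - x⟫ := by
    rw [← inner_add_right, add_comm, sub_add_sub_cancel]
  rw [add_comm (x - x₀), sub_add_sub_cancel] at h₂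
  simp only [hw, h₂, h₃] at h₁
  rw [inner_add_left, inner_add_left]
  linarith

end Quad

/-- (AE Theorem) If `F` is closed and satisfies positivity, `u` is `lam`-quasi-convex on the
open set `U`, and the a.e. 2-jet of `u` lies in `F`, then `u` is `F`-subharmonic on `U`. -/
theorem stmt_14 {n : ℕ} (F : Set (Jet n)) (hFc : IsClosed F) (hFp : Positivity F)
    (U : Set (EuclideanSpace ℝ (Fin n))) (hU : IsOpen U)
    (u : EuclideanSpace ℝ (Fin n) → ℝ) (lam : ℝ) (hlam : 0 ≤ lam)
    (hqc : QCOn lam U u)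
    (hae : ∀ᵐ x ∂(volume.restrict U),
      ∃ (g : EuclideanSpace ℝ (Fin n)) (H : Matrix (Fin n) (Fin n) ℝ),
        H.IsSymm ∧ TwiceDiffAt u x g H ∧ (x, u x, g, H) ∈ F) :
    Subharm F U u := by
  intro x₀ hx₀ p A hA hc
  have hε : ∀ ε : ℝ, 0 < ε → (x₀, u x₀, p, A + ε • (1 : Matrix (Fin n) (Fin n) ℝ)) ∈ F := by
    intro ε hε
    have hAε : (A + ε • 1 : Matrix (Fin n) (Fin n) ℝ).IsSymm := hA.add (by
      rw [Matrix.IsSymm, Matrix.transpose_smul, Matrix.transpose_one])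
    have hfreq : ∃ᶠ z : EuclideanSpace ℝ (Fin n) × EuclideanSpace ℝ (Fin n) in 𝓝 (x₀, 0),
        (z.1, u z.1, p + Matrix.toEuclideanCLM (𝕜 := ℝ) (A + ε • 1) (z.1 - x₀) + z.2,
          A + ε • (1 : Matrix (Fin n) (Fin n) ℝ)) ∈ F := by
      refine Metric.nhds_basis_ball.frequently_iff.2 fun δ hδ => ?_
      obtain ⟨x, q, ⟨g, H, hH, htd, hF⟩, hx, hq, hxc⟩ :=
        hqc.exists_upperContactJet hlam hU hx₀ hA hc hae hε hδ
      refine ⟨(x, q), ?_, ?_⟩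
      · rw [← ball_prod_same, Set.mem_prod, mem_ball_iff_norm, mem_ball_zero_iff]
        exact ⟨hx, hq⟩
      · obtain ⟨rfl, hP⟩ := htd.eq_and_posSemidef hH hAε hxc
        simpa using hFp _ _ _ _ _ hF hP
    refine hFc.mem_of_frequently_of_tendsto hfreq ?_
    have hu : ContinuousAt u x₀ := (hqc.continuousOn hU).continuousAt (hU.mem_nhds hx₀)
    have h₁ : Tendsto (fun z : EuclideanSpace ℝ (Fin n) × EuclideanSpace ℝ (Fin n) => z.1)
      (𝓝 (x₀, 0)) (𝓝 x₀) := continuous_fst.tendsto _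
    have h₂ : Continuous fun z : EuclideanSpace ℝ (Fin n) × EuclideanSpace ℝ (Fin n) =>
      p + Matrix.toEuclideanCLM (𝕜 := ℝ) (A + ε • 1) (z.1 - x₀) + z.2 := by fun_prop
    have h₃ := h₂.tendsto (x₀, 0)
    simp only [sub_self, map_zero, add_zero] at h₃
    exact h₁.prodMk_nhds ((hu.tendsto.comp h₁).prodMk_nhds (h₃.prodMk_nhds tendsto_const_nhds))
  have hcont : Continuous fun ε : ℝ =>
      ((x₀, u x₀, p, A + ε • (1 : Matrix (Fin n) (Fin n) ℝ)) : Jet n) := by fun_prop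
  have hlim := (hcont.tendsto 0).mono_left (nhdsWithin_le_nhds (s := Set.Ioi 0))
  simp only [zero_smul, add_zero] at hlim
  exact hFc.mem_of_tendsto hlim (by filter_upwards [self_mem_nhdsWithin] with ε h using hε ε h)
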